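/- Let $z_0 \in \mathbb{C}$, let $n \ge 0$, and let $f_0, \dots, f_n$ be analytic on a neighborhood of $z_0$; set $f_{n+1} = f_0 + \dots + f_n$. If for some $j \in \{0, 1, \dots, n+1\}$ the function $f_j$ has a zero of multiplicity at least $k$ at $z_0$, where $k \ge n$, then the Wronskian $W = \det(f_j^{(i)})_{i,j=0}^n$ has a zero of multiplicity at least $k - n$ at $z_0$ (or vanishes identically near $z_0$). -/

import Mathlib

open Complex

/-- The Wronskian `det (f_j^{(i)})` of the functions `f 0, …, f n`. -/
noncomputable def wronskian (n : ℕ) (f : Fin (n + 1) → ℂ → ℂ) : ℂ → ℂ :=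
  fun z => Matrix.det (Matrix.of fun i j : Fin (n + 1) => iteratedDeriv i.val (f j) z)

theorem analyticAt_iteratedDeriv {g : ℂ → ℂ} {z : ℂ} (hg : AnalyticAt ℂ g z) (i : ℕ) :
    AnalyticAt ℂ (iteratedDeriv i g) z := by
  rw [iteratedDeriv_eq_iterate]
  exact hg.iterated_deriv i

theorem analyticAt_wronskian {z : ℂ} {n : ℕ} {g : Fin (n + 1) → ℂ → ℂ}
    (hg : ∀ j, AnalyticAt ℂ (g j) z) : AnalyticAt ℂ (wronskian n g) z := by
  unfold wronskian
  simp only [Matrix.det_apply', Matrix.of_apply]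
  exact Finset.analyticAt_fun_sum _ fun σ _ => analyticAt_const.mul
    (Finset.analyticAt_fun_prod _ fun i _ => analyticAt_iteratedDeriv (hg i) _)

/-- Differentiating `i` times lowers the order of vanishing by at most `i`. -/
theorem natCast_sub_le_analyticOrderAt_iteratedDeriv {g : ℂ → ℂ} {z : ℂ} {k : ℕ}
    (hg : AnalyticAt ℂ g z) (hzero : ∀ i < k, iteratedDeriv i g z = 0) (i : ℕ) :
    ((k - i : ℕ) : ℕ∞) ≤ analyticOrderAt (iteratedDeriv i g) z := by
  rw [natCast_le_analyticOrderAt_iff_iteratedDeriv_eq_zero (analyticAt_iteratedDeriv hg i)]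
  intro m hm
  have := hzero (m + i) (by omega)
  rwa [iteratedDeriv_eq_iterate, Function.iterate_add_apply, ← iteratedDeriv_eq_iterate,
    ← iteratedDeriv_eq_iterate] at this

/-- If one of the functions vanishes to order `k`, their Wronskian vanishes to order `k - n`. -/
theorem iteratedDeriv_wronskian_eq_zero {z : ℂ} {n k : ℕ} {g : Fin (n + 1) → ℂ → ℂ}
    (hg : ∀ j, AnalyticAt ℂ (g j) z) (j : Fin (n + 1))
    (hzero : ∀ i < k, iteratedDeriv i (g j) z = 0) :
    ∀ i < k - n, iteratedDeriv i (wronskian n g) z = 0 := by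
  rw [← natCast_le_analyticOrderAt_iff_iteratedDeriv_eq_zero (analyticAt_wronskian hg)]
  have hexp : wronskian n g = ∑ σ : Equiv.Perm (Fin (n + 1)),
      iteratedDeriv (σ j).val (g j) * fun w => ((Equiv.Perm.sign σ : ℤ) : ℂ) *
        ∏ i ∈ Finset.univ.erase j, iteratedDeriv (σ i).val (g i) w := by
    funext w
    simp only [wronskian, Matrix.det_apply', Matrix.of_apply, Finset.sum_apply, Pi.mul_apply]
    refine Finset.sum_congr rfl fun σ _ => ?_
    rw [← Finset.mul_prod_erase _ _ (Finset.mem_univ j)]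
    ring
  rw [hexp]
  refine Finset.sum_induction _ (fun h => ((k - n : ℕ) : ℕ∞) ≤ analyticOrderAt h z)
    (fun a b ha hb => (le_min ha hb).trans le_analyticOrderAt_add) ?_ fun σ _ => ?_
  · rw [analyticOrderAt_eq_top.2 (by simp)]
    exact le_top
  · rw [analyticOrderAt_mul (analyticAt_iteratedDeriv (hg j) _) (analyticAt_const.fun_mul
      (Finset.analyticAt_fun_prod _ fun i _ => analyticAt_iteratedDeriv (hg i) _))]
    refine le_add_right (le_trans ?_
      (natCast_sub_le_analyticOrderAt_iteratedDeriv (hg j) hzero (σ j)))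
    exact_mod_cast Nat.sub_le_sub_left (Nat.lt_succ_iff.1 (σ j).isLt) k

/-- Replacing one function by the sum of all of them does not change the Wronskian. -/
theorem wronskian_update_sum_eventuallyEq {z : ℂ} {n : ℕ} {g : Fin (n + 1) → ℂ → ℂ}
    (hg : ∀ j, AnalyticAt ℂ (g j) z) (j : Fin (n + 1)) :
    wronskian n (Function.update g j fun w => ∑ l, g l w) =ᶠ[nhds z] wronskian n g := by
  filter_upwards [Filter.eventually_all.2 fun l => (hg l).eventually_analyticAt] with w hw
  simp only [wronskian]
  have := Matrix.det_updateCol_sum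
    (Matrix.of fun i l : Fin (n + 1) => iteratedDeriv i.val (g l) w) j (fun _ => 1)
  rw [one_smul] at this
  rw [← this]
  congr 1
  ext i l
  rcases eq_or_ne l j with rfl | hl
  · simp only [Matrix.of_apply, Function.update_self, Matrix.updateCol_self, one_smul]
    exact iteratedDeriv_fun_sum fun l _ => (hw l).contDiffAt
  · simp [hl]

/-- If `f 0, …, f n` are analytic near `z₀`, `f (n+1) = f 0 + ⋯ + f n`, and some `f j`
(`0 ≤ j ≤ n+1`) has a zero of multiplicity at least `k ≥ n` at `z₀` (i.e. it and its
first `k - 1` derivatives vanish there), then the Wronskian of `f 0, …, f n` has a zero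
of multiplicity at least `k - n` at `z₀`. -/
theorem wronskian_zero_order (z₀ : ℂ) (n : ℕ) (f : Fin (n + 2) → ℂ → ℂ)
    (hf : ∀ j : Fin (n + 1), AnalyticAt ℂ (f j.castSucc) z₀)
    (hsum : f (Fin.last (n + 1)) = fun z => ∑ j : Fin (n + 1), f j.castSucc z)
    (k : ℕ) (hk : n ≤ k) (j : Fin (n + 2))
    (hzero : ∀ i < k, iteratedDeriv i (f j) z₀ = 0) :
    ∀ i < k - n, iteratedDeriv i (wronskian n fun j => f j.castSucc) z₀ = 0 := by
  induction j using Fin.lastCases with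
  | cast j => exact iteratedDeriv_wronskian_eq_zero hf j hzero
  | last =>
    intro i hi
    rw [← (wronskian_update_sum_eventuallyEq hf 0).iteratedDeriv_eq i]
    refine iteratedDeriv_wronskian_eq_zero (fun l => ?_) 0 (k := k) ?_ i hi
    · rcases eq_or_ne l 0 with rfl | hl
      · rw [Function.update_self]
        exact Finset.analyticAt_fun_sum _ fun l _ => hf l
      · rw [Function.update_of_ne hl]
        exact hf l
    · rwa [Function.update_self, ← hsum]
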